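/- Let L be the weighted Laplacian matrix of a connected weighted undirected graph on n vertices, let D = diag(d₁,…,dₙ) with dᵢ > 0, and let v, I ∈ ℝⁿ with Σᵢ Iᵢ > 0. For κ > 0 define V(κ) = (L + κD)⁻¹(κD v + I). Then every component of V(κ) tends to +∞ as κ → 0⁺. -/

import Mathlib

open Matrix Filter Topology Finset

lemma aux_sum {n : ℕ} (L : Matrix (Fin n) (Fin n) ℝ)
    (hsym : L.IsSymm) (hL1 : L *ᵥ (fun _ => (1 : ℝ)) = 0) (x : Fin n → ℝ) :
    ∑ i, (L *ᵥ x) i = 0 := by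
  have h : (fun _ => (1 : ℝ)) ⬝ᵥ (L *ᵥ x) = 0 := by
    rw [dotProduct_mulVec, ← mulVec_transpose, hsym.eq, hL1, zero_dotProduct]
  simpa [dotProduct] using h

lemma aux_range {n : ℕ} (hn : 0 < n) (L : Matrix (Fin n) (Fin n) ℝ)
    (hsym : L.IsSymm) (hL1 : L *ᵥ (fun _ => (1 : ℝ)) = 0)
    (hker : ∀ x : Fin n → ℝ, L *ᵥ x = 0 → ∃ c : ℝ, x = fun _ => c)
    (r : Fin n → ℝ) (hr : ∑ i, r i = 0) : ∃ w, L *ᵥ w = r := by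
  have hn' : (n : ℝ) ≠ 0 := by positivity
  let f : (Fin n → ℝ) →ₗ[ℝ] (Fin n → ℝ) := (L + Matrix.of fun _ _ => (1 : ℝ)).mulVecLin
  have hf : ∀ x, f x = L *ᵥ x + fun _ => ∑ i, x i := by
    intro x
    simp only [f, Matrix.mulVecLin_apply, Matrix.add_mulVec]
    congr 1
    ext i
    simp [Matrix.mulVec, dotProduct]
  have key : ∀ x, ∑ i, f x i = 0 → f x = L *ᵥ x ∧ ∑ i, x i = 0 := by
    intro x hx
    have h0 : ∑ i, x i = 0 := by
      rw [hf] at hx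
      simp only [Pi.add_apply, Finset.sum_add_distrib, aux_sum L hsym hL1] at hx
      simpa [hn'] using hx
    refine ⟨?_, h0⟩
    rw [hf, h0]
    ext i; simp
  have hinj : Function.Injective f := by
    rw [injective_iff_map_eq_zero]
    intro x hx
    obtain ⟨h1, h2⟩ := key x (by simp [hx])
    obtain ⟨c, rfl⟩ := hker x (by rw [← h1, hx])
    have : c = 0 := by simpa [hn'] using h2
    ext i; simp [this]
  obtain ⟨w, hw⟩ := LinearMap.injective_iff_surjective.mp hinj r
  obtain ⟨h1, -⟩ := key w (by rw [hw, hr])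
  exact ⟨w, by rw [← h1, hw]⟩

lemma aux_bound {n : ℕ} (L : Matrix (Fin n) (Fin n) ℝ) (hpsd : L.PosSemidef)
    (d : Fin n → ℝ) (hd : ∀ i, 0 < d i) (u e : Fin n → ℝ) (κ : ℝ) (hκ : 0 < κ)
    (he : L *ᵥ e + (fun i => κ * (d i * e i)) = fun i => κ * (d i * u i)) (i : Fin n) :
    d i * e i ^ 2 ≤ ∑ j, d j * u j ^ 2 := by
  have h0 : 0 ≤ e ⬝ᵥ (L *ᵥ e) := by simpa using hpsd.dotProduct_mulVec_nonneg e
  have h1 : e ⬝ᵥ (L *ᵥ e) = κ * ∑ j, d j * (e j * u j - e j ^ 2) := by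
    rw [eq_sub_of_add_eq he, dotProduct, Finset.mul_sum]
    refine Finset.sum_congr rfl fun j _ => ?_
    simp only [Pi.sub_apply]; ring
  have h2 : 0 ≤ ∑ j, d j * (e j * u j - e j ^ 2) := by
    rw [h1] at h0
    exact nonneg_of_mul_nonneg_right h0 hκ
  have h3 : ∑ j, d j * (e j * u j - e j ^ 2) ≤ ∑ j, (d j * u j ^ 2 - d j * e j ^ 2) / 2 := by
    refine Finset.sum_le_sum fun j _ => ?_
    nlinarith [mul_nonneg (hd j).le (sq_nonneg (e j - u j))]
  rw [← Finset.sum_div, Finset.sum_sub_distrib] at h3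
  have h4 : d i * e i ^ 2 ≤ ∑ j, d j * e j ^ 2 :=
    Finset.single_le_sum (f := fun j => d j * e j ^ 2)
      (fun j _ => mul_nonneg (hd j).le (sq_nonneg _)) (Finset.mem_univ i)
  linarith

/-- If `Σᵢ Iᵢ > 0`, every component of
`V(κ) = (L + κD)⁻¹(κD v + I)` tends to `+∞` as `κ → 0⁺`. -/
theorem stmt_9 (n : ℕ) (L : Matrix (Fin n) (Fin n) ℝ)
    (hsym : L.IsSymm) (hpsd : L.PosSemidef)
    (hL1 : L *ᵥ (fun _ => (1 : ℝ)) = 0)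
    (hker : ∀ x : Fin n → ℝ, L *ᵥ x = 0 → ∃ c : ℝ, x = fun _ => c)
    (d : Fin n → ℝ) (hd : ∀ i, 0 < d i) (v I : Fin n → ℝ)
    (hI : 0 < ∑ i, I i) :
    ∀ i : Fin n,
      Tendsto
        (fun κ : ℝ =>
          ((L + κ • Matrix.diagonal d)⁻¹ *ᵥ (κ • (Matrix.diagonal d *ᵥ v) + I)) i)
        (𝓝[>] 0) atTop := by
  intro i
  have hn : 0 < n := i.pos
  have hds : 0 < ∑ j, d j := Finset.sum_pos (fun j _ => hd j) ⟨i, Finset.mem_univ i⟩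
  obtain ⟨c, hc⟩ : ∃ c, c = (∑ j, I j) / ∑ j, d j := ⟨_, rfl⟩
  have hcpos : 0 < c := hc ▸ div_pos hI hds
  obtain ⟨w, hw⟩ := aux_range hn L hsym hL1 hker (fun j => I j - c * d j) (by
    rw [Finset.sum_sub_distrib, ← Finset.mul_sum, hc]
    field_simp
    simp)
  obtain ⟨B, hB⟩ : ∃ B, B = (∑ j, d j * (v j - w j) ^ 2) / d i := ⟨_, rfl⟩
  have hlim : Tendsto (fun κ : ℝ => c * κ⁻¹ + (w i - (B + 1))) (𝓝[>] 0) atTop :=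
    tendsto_atTop_add_const_right _ _ (tendsto_inv_nhdsGT_zero.const_mul_atTop hcpos)
  refine tendsto_atTop_mono' _ ?_ hlim
  filter_upwards [self_mem_nhdsWithin] with κ hκ
  have hκ : 0 < κ := hκ
  have hpd : (L + κ • Matrix.diagonal d).PosDef :=
    Matrix.PosDef.posSemidef_add hpsd ((Matrix.PosDef.diagonal hd).smul hκ)
  have hu := (Matrix.isUnit_iff_isUnit_det _).mp hpd.isUnit
  obtain ⟨V, hV⟩ : ∃ V, V = (L + κ • Matrix.diagonal d)⁻¹ *ᵥ
    (κ • (Matrix.diagonal d *ᵥ v) + I) := ⟨_, rfl⟩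
  have hMV : (L + κ • Matrix.diagonal d) *ᵥ V = κ • (Matrix.diagonal d *ᵥ v) + I := by
    rw [hV, Matrix.mulVec_mulVec, Matrix.mul_nonsing_inv _ hu, Matrix.one_mulVec]
  rw [← hV]
  have hb := aux_bound L hpsd d hd (fun j => v j - w j)
    (V - (w + (c * κ⁻¹) • fun _ => (1 : ℝ))) κ hκ (by
      rw [Matrix.mulVec_sub, Matrix.mulVec_add, Matrix.mulVec_smul, hL1, hw]
      ext j
      have := congrFun hMV j
      simp only [Matrix.add_mulVec, Matrix.smul_mulVec, Pi.add_apply, Pi.smul_apply,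
        Matrix.mulVec_diagonal, smul_eq_mul] at this
      simp only [Pi.add_apply, Pi.sub_apply, Pi.smul_apply, Pi.zero_apply, smul_eq_mul]
      have hk : κ * κ⁻¹ = 1 := mul_inv_cancel₀ hκ.ne'
      linear_combination this - c * d j * hk) i
  have hb2 : (V i - (w i + c * κ⁻¹)) ^ 2 ≤ B := by
    rw [hB, le_div_iff₀ (hd i), mul_comm]
    simpa using hb
  nlinarith [sq_nonneg (V i - (w i + c * κ⁻¹) + 1)]
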